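/- For every α ∈ (1,2) and x > 0, E_α(x^α) − e^x/α = ∫_0^∞ e^{-xt} · (−sin(πα)) t^{α−1} / (π(t^{2α} − 2cos(πα)t^α + 1)) dt; the integrand is nonnegative since sin(πα) < 0 for α ∈ (1,2), so x ↦ E_α(x^α) − e^x/α is completely monotonic on (0,∞). -/

import Mathlib

open Real MeasureTheory

/-- The Mittag-Leffler function evaluated at x^α : E_α(x^α) = ∑_{n≥0} x^{αn}/Γ(1+αn). -/
noncomputable def mlPow (α x : ℝ) : ℝ := ∑' n : ℕ, x ^ (α * n) / Real.Gamma (1 + α * n)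

/-- A function is completely monotonic on (0,∞). -/
def CompletelyMonotonicOn (f : ℝ → ℝ) : Prop :=
  ∀ n : ℕ, ∀ x : ℝ, 0 < x → 0 ≤ (-1 : ℝ) ^ n * iteratedDeriv n f x

/-- The spectral density of `x ↦ E_α(x ^ α) - exp x / α`. -/
noncomputable def mlKernel (α t : ℝ) : ℝ :=
  (-Real.sin (Real.pi * α)) * t ^ (α - 1) /
    (Real.pi * (t ^ (2 * α) - 2 * Real.cos (Real.pi * α) * t ^ α + 1))

theorem sin_pi_mul_neg {α : ℝ} (hα : α ∈ Set.Ioo (1 : ℝ) 2) : Real.sin (π * α) < 0 := by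
  rw [← Real.sin_sub_two_pi]
  apply Real.sin_neg_of_neg_of_neg_pi_lt <;> nlinarith [Real.pi_pos, hα.1, hα.2]

theorem mlKernel_denom_eq (α : ℝ) {t : ℝ} (ht : 0 ≤ t) :
    t ^ (2 * α) - 2 * Real.cos (π * α) * t ^ α + 1 =
      (t ^ α - Real.cos (π * α)) ^ 2 + Real.sin (π * α) ^ 2 := by
  rw [mul_comm 2 α, Real.rpow_mul ht, Real.rpow_two]
  linear_combination -Real.sin_sq_add_cos_sq (π * α)

theorem mlKernel_denom_pos {α : ℝ} (hα : α ∈ Set.Ioo (1 : ℝ) 2) {t : ℝ} (ht : 0 ≤ t) :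
    0 < t ^ (2 * α) - 2 * Real.cos (π * α) * t ^ α + 1 := by
  rw [mlKernel_denom_eq α ht]
  nlinarith [sq_nonneg (t ^ α - Real.cos (π * α)), sin_pi_mul_neg hα]

theorem mlKernel_nonneg {α : ℝ} (hα : α ∈ Set.Ioo (1 : ℝ) 2) {t : ℝ} (ht : 0 ≤ t) :
    0 ≤ mlKernel α t := by
  have h1 := sin_pi_mul_neg hα
  have h2 := mlKernel_denom_pos hα ht
  exact div_nonneg (mul_nonneg (by linarith) (by positivity)) (by positivity)

theorem measurable_mlKernel (α : ℝ) : Measurable (mlKernel α) := by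
  unfold mlKernel
  fun_prop

/-- An explicit antiderivative of the kernel is a multiple of `arctan`. -/
theorem integrableOn_mlKernel {α : ℝ} (hα : α ∈ Set.Ioo (1 : ℝ) 2) :
    IntegrableOn (mlKernel α) (Set.Ioi 0) := by
  have hs := sin_pi_mul_neg hα
  have hα0 : 0 < α := by linarith [hα.1]
  have hcont : Continuous fun t : ℝ ↦ t ^ α := Real.continuous_rpow_const hα0.le
  refine integrableOn_Ioi_deriv_of_nonneg
    (g := fun t ↦ -(1 / (π * α)) *
      Real.arctan ((t ^ α - Real.cos (π * α)) / Real.sin (π * α)))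
    (l := -(1 / (π * α)) * -(π / 2)) ?_ ?_ ?_ ?_
  · have : Continuous fun t ↦ -(1 / (π * α)) *
        Real.arctan ((t ^ α - Real.cos (π * α)) / Real.sin (π * α)) := by fun_prop
    exact this.continuousWithinAt
  · intro t (ht : 0 < t)
    have h := (((Real.hasDerivAt_rpow_const (p := α) (Or.inl ht.ne')).sub_const
      (Real.cos (π * α))).div_const (Real.sin (π * α))).arctan.const_mul (-(1 / (π * α)))
    refine h.congr_deriv ?_
    have hd := mlKernel_denom_pos hα ht.le
    have hk : mlKernel α t = -Real.sin (π * α) * t ^ (α - 1) /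
        (π * ((t ^ α - Real.cos (π * α)) ^ 2 + Real.sin (π * α) ^ 2)) := by
      rw [← mlKernel_denom_eq α ht.le, mlKernel]
    rw [mlKernel_denom_eq α ht.le] at hd
    refine Eq.trans ?_ hk.symm
    have hs' := hs.ne
    have h1 : 1 + ((t ^ α - Real.cos (π * α)) / Real.sin (π * α)) ^ 2 =
      ((t ^ α - Real.cos (π * α)) ^ 2 + Real.sin (π * α) ^ 2) / Real.sin (π * α) ^ 2 := by
      field_simp
      ring
    rw [h1]
    field_simp
  · intro t (ht : 0 < t)
    exact mlKernel_nonneg hα ht.le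
  · refine Filter.Tendsto.const_mul _ ?_
    have h2 : Filter.Tendsto (fun t : ℝ ↦ (t ^ α - Real.cos (π * α)) / Real.sin (π * α))
        Filter.atTop Filter.atBot := by
      refine Filter.Tendsto.atTop_div_const_of_neg hs ?_
      exact Filter.tendsto_atTop_add_const_right _ _ (tendsto_rpow_atTop hα0)
    exact (Real.tendsto_arctan_atBot.mono_right nhdsWithin_le_nhds).comp h2

open ProbabilityTheory in
/-- Finite measures whose moment generating functions agree and are finite on a neighbourhood
of `-∞` containing the origin are equal. -/
theorem measure_ext_of_mgf_eqOn_Iio {μ ν : Measure ℝ} [IsFiniteMeasure μ] [IsFiniteMeasure ν]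
    {c : ℝ} (hc : 0 < c) (hμ : Set.Iio c ⊆ integrableExpSet id μ)
    (hν : Set.Iio c ⊆ integrableExpSet id ν) (h : Set.EqOn (mgf id μ) (mgf id ν) (Set.Iio c)) :
    μ = ν := by
  have hs (ρ : Measure ℝ) (hρ : Set.Iio c ⊆ integrableExpSet id ρ) :
      AnalyticOnNhd ℂ (complexMGF id ρ) {z | z.re < c} := fun z hz ↦
    analyticAt_complexMGF (interior_mono hρ (by rwa [isOpen_Iio.interior_eq]))
  have key : Set.EqOn (complexMGF id μ) (complexMGF id ν) {z | z.re < c} := by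
    refine (hs μ hμ).eqOn_of_preconnected_of_frequently_eq (hs ν hν)
      (convex_halfSpace_re_lt c).isPreconnected (z₀ := 0) (by simpa using hc) ?_
    have h1 : ∃ᶠ x : ℝ in nhdsWithin 0 {0}ᶜ, complexMGF id μ x = complexMGF id ν x := by
      refine Filter.Eventually.frequently ?_
      filter_upwards [nhdsWithin_le_nhds (Iio_mem_nhds hc)] with x hx
      rw [complexMGF_ofReal, complexMGF_ofReal, h hx]
    refine Filter.Tendsto.frequently (f := fun x : ℝ ↦ (x : ℂ)) ?_ h1
    refine tendsto_nhdsWithin_iff.2 ⟨?_, ?_⟩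
    · exact (Complex.continuous_ofReal.tendsto' 0 0 (by simp)).mono_left nhdsWithin_le_nhds
    · filter_upwards [self_mem_nhdsWithin] with x hx
      simpa using hx
  refine Measure.ext_of_charFun ?_
  ext t
  rw [← complexMGF_id_mul_I, ← complexMGF_id_mul_I]
  exact key (by simpa using hc)

open ProbabilityTheory in
/-- Uniqueness of the Laplace transform for nonnegative continuous functions on `(0, ∞)`. -/
theorem eqOn_Ioi_of_lintegral_laplace_eq {f g : ℝ → ℝ} {a : ℝ}
    (hf : ContinuousOn f (Set.Ioi 0)) (hg : ContinuousOn g (Set.Ioi 0))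
    (hf0 : ∀ x, 0 < x → 0 ≤ f x) (hg0 : ∀ x, 0 < x → 0 ≤ g x)
    (hfin : ∀ p, a < p → ∫⁻ x in Set.Ioi 0, ENNReal.ofReal (rexp (-p * x) * f x) ≠ ⊤)
    (h : ∀ p, a < p → ∫⁻ x in Set.Ioi 0, ENNReal.ofReal (rexp (-p * x) * f x) =
      ∫⁻ x in Set.Ioi 0, ENNReal.ofReal (rexp (-p * x) * g x)) :
    Set.EqOn f g (Set.Ioi 0) := by
  set m : (ℝ → ℝ) → Measure ℝ := fun f ↦ (volume.restrict (Set.Ioi 0)).withDensity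
    fun x ↦ ENNReal.ofReal (rexp (-(a + 1) * x) * f x) with hm
  have hmeas {f : ℝ → ℝ} (hf : ContinuousOn f (Set.Ioi 0)) (p : ℝ) :
      AEMeasurable (fun x ↦ ENNReal.ofReal (rexp (-p * x) * f x))
        (volume.restrict (Set.Ioi 0)) := by
    refine AEMeasurable.ennreal_ofReal (AEMeasurable.mul (by fun_prop) ?_)
    exact hf.aemeasurable measurableSet_Ioi
  have hexp {f : ℝ → ℝ} (hf : ContinuousOn f (Set.Ioi 0)) (t : ℝ) :
      ∫⁻ x, ENNReal.ofReal (rexp (t * x)) ∂(m f) =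
        ∫⁻ x in Set.Ioi 0, ENNReal.ofReal (rexp (-(a + 1 - t) * x) * f x) := by
    rw [hm, lintegral_withDensity_eq_lintegral_mul₀ (hmeas hf _) (by fun_prop)]
    refine lintegral_congr fun x ↦ ?_
    rw [Pi.mul_apply, mul_comm, ← ENNReal.ofReal_mul (by positivity), ← mul_assoc,
      ← Real.exp_add]
    ring_nf
  have hmass (f : ℝ → ℝ) : (m f) Set.univ =
      ∫⁻ x in Set.Ioi 0, ENNReal.ofReal (rexp (-(a + 1) * x) * f x) := by
    simp [hm]
  have hgfin : ∀ p, a < p → ∫⁻ x in Set.Ioi 0, ENNReal.ofReal (rexp (-p * x) * g x) ≠ ⊤ :=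
    fun p hp ↦ h p hp ▸ hfin p hp
  have : IsFiniteMeasure (m f) := ⟨by rw [hmass]; exact (hfin _ (by linarith)).lt_top⟩
  have : IsFiniteMeasure (m g) := ⟨by rw [hmass]; exact (hgfin _ (by linarith)).lt_top⟩
  have hint {f : ℝ → ℝ} (hf : ContinuousOn f (Set.Ioi 0))
      (hfin : ∀ p, a < p → ∫⁻ x in Set.Ioi 0, ENNReal.ofReal (rexp (-p * x) * f x) ≠ ⊤) :
      Set.Iio 1 ⊆ integrableExpSet id (m f) := by
    intro t (ht : t < 1)
    refine (lintegral_ofReal_ne_top_iff_integrable (by fun_prop)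
      (Filter.Eventually.of_forall fun x ↦ by positivity)).1 ?_
    simp only [id]
    rw [hexp hf]
    exact hfin _ (by linarith)
  have heq : m f = m g := by
    refine measure_ext_of_mgf_eqOn_Iio one_pos (hint hf hfin) (hint hg hgfin) ?_
    intro t (ht : t < 1)
    simp only [mgf, id]
    rw [integral_eq_lintegral_of_nonneg_ae (Filter.Eventually.of_forall fun x ↦ by positivity)
      (by fun_prop), integral_eq_lintegral_of_nonneg_ae
      (Filter.Eventually.of_forall fun x ↦ by positivity) (by fun_prop), hexp hf, hexp hg,
      h _ (by linarith)]
  have hae := (withDensity_eq_iff (hmeas hf _) (hmeas hg _) (hfin _ (by linarith))).1 heq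
  refine Measure.eqOn_open_of_ae_eq (μ := volume) ?_ isOpen_Ioi hf hg
  filter_upwards [hae, ae_restrict_mem measurableSet_Ioi] with x hx hx0
  have := (ENNReal.ofReal_eq_ofReal_iff (mul_nonneg (by positivity) (hf0 x hx0))
    (mul_nonneg (by positivity) (hg0 x hx0))).1 hx
  exact mul_left_cancel₀ (Real.exp_pos _).ne' this

theorem Complex.exp_eq_exp_ofReal_iff {w : ℂ} (hw : |w.im| < 2 * π) (a : ℝ) :
    Complex.exp w = Complex.exp a ↔ w = a := by
  refine ⟨fun h ↦ ?_, fun h ↦ h ▸ rfl⟩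
  obtain ⟨n, hn⟩ := Complex.exp_eq_exp_iff_exists_int.1 h
  have him : w.im = n * (2 * π) := by simpa using congrArg Complex.im hn
  rw [him, abs_mul, abs_of_pos Real.two_pi_pos] at hw
  have h1 : |(n : ℝ)| < 1 := by
    by_contra! h2
    nlinarith [Real.two_pi_pos]
  have h2 : n = 0 := by
    rw [← Int.abs_lt_one_iff]
    exact_mod_cast h1
  simpa [h2] using hn

theorem Complex.differentiable_dslope_exp (a : ℂ) : Differentiable ℂ (dslope Complex.exp a) := by
  rw [← differentiableOn_univ, Complex.differentiableOn_dslope Filter.univ_mem]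
  exact Complex.differentiable_exp.differentiableOn

theorem Complex.dslope_exp_ne_zero {w : ℂ} (hw : |w.im| < 2 * π) (a : ℝ) :
    dslope Complex.exp (a : ℂ) w ≠ 0 := by
  by_cases h : w = a
  · rw [h, dslope_same, Complex.deriv_exp]
    exact Complex.exp_ne_zero _
  · have h1 := sub_smul_dslope Complex.exp (a : ℂ) w
    intro h2
    rw [h2, smul_zero] at h1
    exact h ((Complex.exp_eq_exp_ofReal_iff hw a).1 (sub_eq_zero.1 h1.symm))

/-- The function `1 / (s ^ α - 1) - 1 / (α (s - 1))` in the logarithmic coordinate `s = exp w`. -/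
noncomputable def logCoordAux (α : ℝ) (w : ℂ) : ℂ :=
  (Complex.exp (α * w) - 1)⁻¹ - (α : ℂ)⁻¹ * (Complex.exp w - 1)⁻¹

theorem exists_differentiableOn_eq_logCoordAux {α : ℝ} (hα : 1 < α) :
    ∃ B : ℂ → ℂ, DifferentiableOn ℂ B {w | |w.im| < 2 * π / α} ∧
      ∀ w ∈ {w : ℂ | |w.im| < 2 * π / α}, w ≠ 0 → B w = logCoordAux α w := by
  have hα0 : 0 < α := by linarith
  have hα' : (α : ℂ) ≠ 0 := by exact_mod_cast hα0.ne'
  have hU : IsOpen {w : ℂ | |w.im| < 2 * π / α} :=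
    isOpen_lt (by fun_prop) continuous_const
  have hU1 {w : ℂ} (hw : |w.im| < 2 * π / α) : |w.im| < 2 * π :=
    hw.trans (div_lt_self Real.two_pi_pos hα)
  have hU2 {w : ℂ} (hw : |w.im| < 2 * π / α) : |((α : ℂ) * w).im| < 2 * π := by
    rw [Complex.im_ofReal_mul, abs_mul, abs_of_pos hα0]
    rwa [lt_div_iff₀ hα0, mul_comm] at hw
  have hexp (w : ℂ) : Complex.exp w - 1 = w * dslope Complex.exp ((0 : ℝ) : ℂ) w := by
    simpa using (sub_smul_dslope Complex.exp ((0 : ℝ) : ℂ) w).symm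
  set φ := dslope Complex.exp ((0 : ℝ) : ℂ) with hφ
  have hφd : Differentiable ℂ φ := Complex.differentiable_dslope_exp _
  set N : ℂ → ℂ := fun w ↦ (α * φ (α * w))⁻¹ - (α * φ w)⁻¹ with hN
  refine ⟨dslope N 0, ?_, fun w hw hw0 ↦ ?_⟩
  · rw [Complex.differentiableOn_dslope (hU.mem_nhds (by simp; positivity))]
    intro w hw
    refine DifferentiableAt.differentiableWithinAt (DifferentiableAt.sub ?_ ?_)
    · refine DifferentiableAt.inv (by fun_prop) (mul_ne_zero hα' ?_)
      exact Complex.dslope_exp_ne_zero (hU2 hw) 0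
    · refine DifferentiableAt.inv (by fun_prop) (mul_ne_zero hα' ?_)
      exact Complex.dslope_exp_ne_zero (hU1 hw) 0
  · have h1 : φ (α * w) ≠ 0 := Complex.dslope_exp_ne_zero (hU2 hw) 0
    have h2 : φ w ≠ 0 := Complex.dslope_exp_ne_zero (hU1 hw) 0
    rw [dslope_of_ne _ hw0, slope_def_field, logCoordAux, hexp, hexp]
    simp only [hN, mul_zero, sub_self, sub_zero]
    field_simp

theorem exists_differentiableOn_eq_logCoordAux_div {α p : ℝ} (hα : 1 < α) (hp : 1 < p) :
    ∃ H : ℂ → ℂ, DifferentiableOn ℂ H {w | |w.im| < 2 * π / α} ∧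
      ∀ w ∈ {w : ℂ | |w.im| < 2 * π / α}, w ≠ 0 → w ≠ Real.log p →
        H w = (logCoordAux α w - logCoordAux α (Real.log p)) / (p - Complex.exp w) := by
  obtain ⟨B, hBd, hB⟩ := exists_differentiableOn_eq_logCoordAux hα
  have hU : IsOpen {w : ℂ | |w.im| < 2 * π / α} :=
    isOpen_lt (by fun_prop) continuous_const
  have hU1 {w : ℂ} (hw : |w.im| < 2 * π / α) : |w.im| < 2 * π :=
    hw.trans (div_lt_self Real.two_pi_pos hα)
  have hl : ((Real.log p : ℝ) : ℂ) ∈ {w : ℂ | |w.im| < 2 * π / α} := by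
    simp only [Set.mem_ofPred_eq, Complex.ofReal_im, abs_zero]
    have := Real.pi_pos
    positivity
  have hl0 : ((Real.log p : ℝ) : ℂ) ≠ 0 := by exact_mod_cast (Real.log_pos hp).ne'
  have hpe : Complex.exp (Real.log p) = p := by
    rw [← Complex.ofReal_exp, Real.exp_log (by linarith)]
  refine ⟨fun w ↦ -dslope B (Real.log p) w / dslope Complex.exp (Real.log p) w, ?_, ?_⟩
  · refine DifferentiableOn.div ?_ (Complex.differentiable_dslope_exp _).differentiableOn
      fun w hw ↦ Complex.dslope_exp_ne_zero (hU1 hw) _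
    exact ((Complex.differentiableOn_dslope (hU.mem_nhds hl)).2 hBd).neg
  · intro w hw hw0 hwl
    have hne := (Complex.exp_eq_exp_ofReal_iff (hU1 hw) (Real.log p)).not.2 hwl
    rw [hpe, ← ne_eq] at hne
    have h1 : Complex.exp w - p ≠ 0 := sub_ne_zero.2 hne
    have h2 : p - Complex.exp w ≠ 0 := sub_ne_zero.2 hne.symm
    have h3 : w - Real.log p ≠ 0 := sub_ne_zero.2 hwl
    simp only [dslope_of_ne _ hwl, slope_def_field, hpe, hB w hw hw0, hB _ hl hl0]
    field_simp
    ring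

theorem tendsto_intervalIntegral_vertical {F : ℂ → ℂ} {l : Filter ℝ} [l.IsCountablyGenerated]
    {L : ℂ} (hF : Measurable F) (h : Filter.Tendsto F (Filter.comap Complex.re l) (nhds L))
    (a b : ℝ) :
    Filter.Tendsto (fun R : ℝ ↦ ∫ y in a..b, F (R + y * Complex.I)) l
      (nhds ((b - a) * L)) := by
  have hlim (y : ℝ) : Filter.Tendsto (fun R : ℝ ↦ F (R + y * Complex.I)) l (nhds L) := by
    refine h.comp (Filter.tendsto_comap_iff.2 ?_)
    simp only [Function.comp_def, Complex.add_re, Complex.ofReal_re, Complex.re_ofReal_mul,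
      Complex.I_re, mul_zero, add_zero]
    exact Filter.tendsto_id
  have hb : ∀ᶠ w in Filter.comap Complex.re l, ‖F w‖ < ‖L‖ + 1 :=
    h.norm.eventually_lt_const (by linarith)
  have key := intervalIntegral.tendsto_integral_filter_of_dominated_convergence
    (F := fun (R y : ℝ) ↦ F (R + y * Complex.I)) (f := fun _ ↦ L) (μ := volume) (a := a) (b := b)
    (l := l) (fun _ ↦ ‖L‖ + 1) (Filter.Eventually.of_forall fun R ↦ ?_) ?_ (by simp) ?_
  · simpa using key
  · exact (hF.comp (by fun_prop)).aestronglyMeasurable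
  · filter_upwards [Filter.eventually_comap.1 hb] with R hR
    exact Filter.Eventually.of_forall fun y _ ↦ (hR _ (by simp)).le
  · exact Filter.Eventually.of_forall fun y _ ↦ hlim y

theorem tendsto_logCoordAux_atTop {α : ℝ} (hα : 0 < α) :
    Filter.Tendsto (logCoordAux α) (Filter.comap Complex.re Filter.atTop) (nhds 0) := by
  have hscale : Filter.Tendsto (fun w : ℂ ↦ (α : ℂ) * w) (Filter.comap Complex.re Filter.atTop)
      (Filter.comap Complex.re Filter.atTop) := by
    refine Filter.tendsto_comap_iff.2 ?_
    simpa [Function.comp_def] using Filter.tendsto_comap.const_mul_atTop hα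
  have h1 : Filter.Tendsto (fun w : ℂ ↦ (Complex.exp w - 1)⁻¹)
      (Filter.comap Complex.re Filter.atTop) (nhds 0) := by
    refine Filter.tendsto_inv₀_cobounded.comp ?_
    exact (tendsto_sub_const_cobounded 1).comp Complex.tendsto_exp_comap_re_atTop
  have h2 := (h1.comp hscale).sub (h1.const_mul (α : ℂ)⁻¹)
  rw [mul_zero, sub_zero] at h2
  exact h2

theorem tendsto_logCoordAux_atBot {α : ℝ} (hα : 0 < α) :
    Filter.Tendsto (logCoordAux α) (Filter.comap Complex.re Filter.atBot)
      (nhds ((α : ℂ)⁻¹ - 1)) := by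
  have hscale : Filter.Tendsto (fun w : ℂ ↦ (α : ℂ) * w) (Filter.comap Complex.re Filter.atBot)
      (Filter.comap Complex.re Filter.atBot) := by
    refine Filter.tendsto_comap_iff.2 ?_
    simpa [Function.comp_def] using Filter.tendsto_comap.const_mul_atBot hα
  have h1 : Filter.Tendsto (fun w : ℂ ↦ (Complex.exp w - 1)⁻¹)
      (Filter.comap Complex.re Filter.atBot) (nhds (-1)) := by
    have := (Complex.tendsto_exp_comap_re_atBot.sub_const 1).inv₀ (by simp)
    simpa [inv_neg] using this
  have h2 := (h1.comp hscale).sub (h1.const_mul (α : ℂ)⁻¹)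
  have h3 : -1 - (α : ℂ)⁻¹ * -1 = (α : ℂ)⁻¹ - 1 := by ring
  rw [h3] at h2
  exact h2

theorem logCoordAux_add_pi_sub {α : ℝ} (hα : α ∈ Set.Ioo (1 : ℝ) 2) (u : ℝ) :
    logCoordAux α (u + π * Complex.I) - logCoordAux α (u - π * Complex.I) =
      2 * π * Complex.I * (rexp u * mlKernel α (rexp u) : ℝ) := by
  have e1 : Complex.exp (u + π * Complex.I) = -Complex.exp u := by
    rw [Complex.exp_add, Complex.exp_pi_mul_I]; ring
  have e2 : Complex.exp (u - π * Complex.I) = -Complex.exp u := by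
    rw [Complex.exp_sub, Complex.exp_pi_mul_I]; ring
  set r := rexp u ^ α with hr
  set c := Real.cos (π * α) with hc
  set s := Real.sin (π * α) with hs
  have hr0 : Complex.exp (α * u) = (r : ℂ) := by
    rw [hr, ← Real.exp_mul]; push_cast; ring_nf
  have e3 : Complex.exp (α * (u + π * Complex.I)) = r * (c + s * Complex.I) := by
    rw [mul_add, Complex.exp_add, hr0, hc, hs, Complex.ofReal_cos, Complex.ofReal_sin,
      ← Complex.exp_mul_I]
    push_cast; ring_nf
  have e4 : Complex.exp (α * (u - π * Complex.I)) = r * (c - s * Complex.I) := by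
    have h1 : Complex.exp (-((π * α : ℝ) : ℂ) * Complex.I) = c - s * Complex.I := by
      rw [Complex.exp_mul_I, Complex.cos_neg, Complex.sin_neg, hc, hs, Complex.ofReal_cos,
        Complex.ofReal_sin]
      ring
    rw [mul_sub, sub_eq_add_neg, Complex.exp_add, hr0, ← h1]
    push_cast; ring_nf
  have hd : 0 < r ^ 2 - 2 * c * r + 1 := by
    have := mlKernel_denom_pos hα (Real.exp_pos u).le
    rwa [mul_comm 2 α, Real.rpow_mul (Real.exp_pos u).le, Real.rpow_two] at this
  have hk : rexp u * mlKernel α (rexp u) = -s * r / (π * (r ^ 2 - 2 * c * r + 1)) := by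
    rw [mlKernel, mul_comm 2 α, Real.rpow_mul (Real.exp_pos u).le, Real.rpow_two,
      Real.rpow_sub_one (Real.exp_pos u).ne', ← hr, ← hc, ← hs]
    field_simp
  have hprod : ((r : ℂ) * (c + s * Complex.I) - 1) * (r * (c - s * Complex.I) - 1) =
      ((r ^ 2 - 2 * c * r + 1 : ℝ) : ℂ) := by
    have h1 : (s : ℂ) ^ 2 + c ^ 2 = 1 := by exact_mod_cast Real.sin_sq_add_cos_sq (π * α)
    push_cast
    linear_combination (r : ℂ) ^ 2 * h1 - (r : ℂ) ^ 2 * s ^ 2 * Complex.I_sq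
  have hd' : ((r ^ 2 - 2 * c * r + 1 : ℝ) : ℂ) ≠ 0 := by exact_mod_cast hd.ne'
  have hne := hprod ▸ hd'
  have hne1 := left_ne_zero_of_mul hne
  have hne2 := right_ne_zero_of_mul hne
  rw [logCoordAux, logCoordAux, e1, e2, e3, e4, hk, sub_sub_sub_cancel_right,
    inv_sub_inv hne1 hne2, hprod]
  have hpi : (π : ℂ) ≠ 0 := by exact_mod_cast Real.pi_ne_zero
  rw [Complex.ofReal_div, Complex.ofReal_mul π]
  field_simp
  push_cast
  ring

theorem integrableOn_mlKernel_div {α p : ℝ} (hα : α ∈ Set.Ioo (1 : ℝ) 2) (hp : 0 < p) :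
    IntegrableOn (fun t ↦ mlKernel α t / (p + t)) (Set.Ioi 0) := by
  refine ((integrableOn_mlKernel hα).const_mul p⁻¹).mono'
    ((measurable_mlKernel α).div (by fun_prop)).aestronglyMeasurable ?_
  filter_upwards [ae_restrict_mem measurableSet_Ioi] with t (ht : 0 < t)
  have hk := mlKernel_nonneg hα ht.le
  rw [Real.norm_of_nonneg (by positivity), inv_mul_eq_div]
  gcongr
  linarith

/-- The Stieltjes transform of the kernel, by contour integration over a strip in the
logarithmic coordinate. -/
theorem integral_mlKernel_div {α p : ℝ} (hα : α ∈ Set.Ioo (1 : ℝ) 2) (hp : 1 < p) :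
    ∫ t in Set.Ioi 0, mlKernel α t / (p + t) =
      p ^ (α - 1) / (p ^ α - 1) - 1 / (α * (p - 1)) := by
  have hp0 : 0 < p := by linarith
  have hα0 : 0 < α := by linarith [hα.1]
  have hpi := Real.pi_pos
  obtain ⟨H, hHd, hH⟩ := exists_differentiableOn_eq_logCoordAux_div hα.1 hp
  set ℓ := Real.log p with hℓ
  have hℓ0 : 0 < ℓ := Real.log_pos hp
  set F : ℂ → ℂ := fun w ↦ (logCoordAux α w - logCoordAux α ℓ) / (p - Complex.exp w) with hF
  set U : Set ℂ := {w : ℂ | |w.im| < 2 * π / α} with hU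
  have hπU : π < 2 * π / α := by
    rw [lt_div_iff₀ hα0]
    nlinarith [hα.2]
  have hU_line (u y : ℝ) (hy : |y| ≤ π) : (u + y * Complex.I : ℂ) ∈ U := by
    simpa [hU] using hy.trans_lt hπU
  have hrange : Set.range rexp = Set.Ioi 0 := Real.range_exp
  set G : ℝ → ℝ := fun u ↦ rexp u * (mlKernel α (rexp u) / (p + rexp u)) with hG
  have hexp_deriv : ∀ x ∈ Set.univ, HasDerivWithinAt rexp (rexp x) Set.univ x :=
    fun x _ ↦ (Real.hasDerivAt_exp x).hasDerivWithinAt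
  have hGint : Integrable G := by
    have h1 := (integrableOn_image_iff_integrableOn_abs_deriv_smul MeasurableSet.univ hexp_deriv
      Real.exp_injective.injOn (fun t ↦ mlKernel α t / (p + t))).1
      (by rw [Set.image_univ, hrange]; exact integrableOn_mlKernel_div hα hp0)
    simpa [abs_of_pos (Real.exp_pos _)] using h1
  have hGeq : ∫ t in Set.Ioi 0, mlKernel α t / (p + t) = ∫ u, G u := by
    have h1 := integral_image_eq_integral_abs_deriv_smul MeasurableSet.univ hexp_deriv
      Real.exp_injective.injOn (fun t ↦ mlKernel α t / (p + t))
    rw [Set.image_univ, hrange] at h1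
    simpa [abs_of_pos (Real.exp_pos _)] using h1
  have hrect (R : ℝ) (hR : ℓ < R) :
      2 * π * Complex.I * (∫ u in -R..R, G u : ℝ) =
        Complex.I * (∫ y in -π..π, F (R + y * Complex.I)) -
          Complex.I * ∫ y in -π..π, F ((-R : ℝ) + y * Complex.I) := by
    have h1 := Complex.integral_boundary_rect_eq_zero_of_differentiableOn H
      (⟨-R, -π⟩ : ℂ) (⟨R, π⟩ : ℂ) (hHd.mono fun w hw ↦ by
        have h2 := (Complex.mem_reProdIm.1 hw).2
        rw [Set.uIcc_of_le (by linarith)] at h2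
        exact (abs_le.2 h2).trans_lt hπU)
    simp only [smul_eq_mul] at h1
    have hvert (S : ℝ) (hS : ℓ < |S|) : ∫ y in -π..π, H (S + y * Complex.I) =
        ∫ y in -π..π, F (S + y * Complex.I) := by
      refine intervalIntegral.integral_congr fun y hy ↦ ?_
      rw [Set.uIcc_of_le (by linarith)] at hy
      refine hH _ (hU_line S y (abs_le.2 hy)) (fun h ↦ ?_) (fun h ↦ ?_)
      · have : S = 0 := by simpa using congrArg Complex.re h
        rw [this, abs_zero] at hS
        linarith
      · have : S = ℓ := by simpa using congrArg Complex.re h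
        rw [this, abs_of_pos hℓ0] at hS
        exact lt_irrefl _ hS
    have hhor (y : ℝ) (hy : |y| ≤ π) (hy0 : y ≠ 0) (u : ℝ) :
        H (u + y * Complex.I) = F (u + y * Complex.I) := by
      refine hH _ (hU_line u y hy) (fun h ↦ ?_) (fun h ↦ ?_) <;>
        exact hy0 (by simpa using congrArg Complex.im h)
    have hcont (y : ℝ) (hy : |y| ≤ π) : Continuous fun u : ℝ ↦ H (u + y * Complex.I) :=
      hHd.continuousOn.comp_continuous (by fun_prop) fun u ↦ hU_line u y hy
    have hπ1 : |(-π)| ≤ π := by rw [abs_neg, abs_of_pos hpi]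
    have hπ2 : |π| ≤ π := by rw [abs_of_pos hpi]
    rw [hvert R (by rwa [abs_of_pos (by linarith)]),
      hvert (-R) (by rwa [abs_neg, abs_of_pos (by linarith)]),
      ← intervalIntegral.integral_sub ((hcont _ hπ1).intervalIntegrable _ _)
        ((hcont _ hπ2).intervalIntegrable _ _)] at h1
    have h3 : ∫ u in -R..R, (H (u + ((-π : ℝ) : ℂ) * Complex.I) - H (u + (π : ℂ) * Complex.I)) =
        -(2 * π * Complex.I * (∫ u in -R..R, G u : ℝ)) := by
      rw [← intervalIntegral.integral_ofReal, ← intervalIntegral.integral_const_mul,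
        ← intervalIntegral.integral_neg]
      refine intervalIntegral.integral_congr fun u _ ↦ ?_
      have h4 := logCoordAux_add_pi_sub hα u
      have e1 : Complex.exp (u + π * Complex.I) = -Complex.exp u := by
        rw [Complex.exp_add, Complex.exp_pi_mul_I]; ring
      have e2 : Complex.exp (u - π * Complex.I) = -Complex.exp u := by
        rw [Complex.exp_sub, Complex.exp_pi_mul_I]; ring
      have e3 : (u : ℂ) + ((-π : ℝ) : ℂ) * Complex.I = u - π * Complex.I := by push_cast; ring
      have h5 : (p : ℂ) + Complex.exp u ≠ 0 := by
        have : p + rexp u ≠ 0 := by positivity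
        exact_mod_cast this
      rw [hhor _ hπ1 (by linarith), hhor _ hπ2 hpi.ne', e3]
      simp only [hF, hG, e1, e2, sub_neg_eq_add]
      rw [← sub_div, sub_sub_sub_cancel_right, ← neg_sub, h4]
      push_cast
      field_simp
    rw [h3] at h1
    linear_combination -h1
  have hmeas : Measurable F := by
    have : Measurable (logCoordAux α) := by unfold logCoordAux; fun_prop
    exact (this.sub_const _).div (by fun_prop)
  have htop : Filter.Tendsto F (Filter.comap Complex.re Filter.atTop) (nhds 0) := by
    have h1 : Filter.Tendsto (fun w : ℂ ↦ ((p : ℂ) - Complex.exp w)⁻¹)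
        (Filter.comap Complex.re Filter.atTop) (nhds 0) := by
      have := (Filter.tendsto_inv₀_cobounded.comp ((tendsto_sub_const_cobounded (p : ℂ)).comp
        Complex.tendsto_exp_comap_re_atTop)).neg
      simpa [Function.comp_def, ← inv_neg] using this
    have h2 := ((tendsto_logCoordAux_atTop hα0).sub_const (logCoordAux α ℓ)).mul h1
    rw [mul_zero] at h2
    exact h2
  have hbot : Filter.Tendsto F (Filter.comap Complex.re Filter.atBot)
      (nhds (((α : ℂ)⁻¹ - 1 - logCoordAux α ℓ) / p)) := by
    have h1 := Complex.tendsto_exp_comap_re_atBot.const_sub (p : ℂ)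
    rw [sub_zero] at h1
    exact ((tendsto_logCoordAux_atBot hα0).sub_const _).div h1 (by exact_mod_cast hp0.ne')
  have hlim1 := tendsto_intervalIntegral_vertical hmeas htop (-π) π
  have hlim2 := (tendsto_intervalIntegral_vertical hmeas hbot (-π) π).comp
    Filter.tendsto_neg_atTop_atBot
  have hlim3 := ((Complex.continuous_ofReal.tendsto _).comp (intervalIntegral_tendsto_integral
    hGint Filter.tendsto_neg_atTop_atBot Filter.tendsto_id)).const_mul (2 * π * Complex.I)
  have huniq := tendsto_nhds_unique (hlim3.congr' (by
    filter_upwards [Filter.eventually_gt_atTop ℓ] with R hR using hrect R hR))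
    ((hlim1.const_mul Complex.I).sub (hlim2.const_mul Complex.I))
  have hpα : 1 < p ^ α := Real.one_lt_rpow hp hα0
  have hℓe : logCoordAux α ℓ = (((p ^ α - 1)⁻¹ - α⁻¹ * (p - 1)⁻¹ : ℝ) : ℂ) := by
    have h1 : rexp (α * ℓ) = p ^ α := by rw [Real.rpow_def_of_pos hp0, mul_comm]
    have h2 : rexp ℓ = p := Real.exp_log hp0
    have h3 : (p - 1)⁻¹ = (rexp ℓ - 1)⁻¹ := by rw [h2]
    rw [logCoordAux, ← h1, h3]
    push_cast
    rfl
  have hpi' : (π : ℂ) ≠ 0 := by exact_mod_cast hpi.ne'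
  have hval : ((∫ u, G u : ℝ) : ℂ) =
      ((-(α⁻¹ - 1 - ((p ^ α - 1)⁻¹ - α⁻¹ * (p - 1)⁻¹)) / p : ℝ) : ℂ) := by
    rw [hℓe] at huniq
    have h2 : (2 * π * Complex.I : ℂ) ≠ 0 := by simp [hpi']
    refine mul_left_cancel₀ h2 (huniq.trans ?_)
    push_cast
    ring
  rw [hGeq, Complex.ofReal_injective hval, Real.rpow_sub_one hp0.ne']
  have h1 : p ^ α - 1 ≠ 0 := by linarith
  have h2 : p - 1 ≠ 0 := by linarith
  field_simp
  ring

theorem pow_div_Gamma_le {α x : ℝ} (hα : 1 ≤ α) (hx : 0 ≤ x) (n : ℕ) :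
    x ^ (α * n) / Real.Gamma (1 + α * n) ≤ (x ^ α) ^ n / n.factorial := by
  rw [Real.rpow_mul hx, Real.rpow_natCast]
  rcases Nat.eq_zero_or_pos n with rfl | hn
  · simp
  have hn1 : (1 : ℝ) ≤ n := by exact_mod_cast hn
  have h2 : (n : ℝ) ≤ α * n := le_mul_of_one_le_left (by positivity) hα
  rw [← Real.Gamma_nat_eq_factorial]
  have hΓ : 0 < Real.Gamma (n + 1) := Real.Gamma_pos_of_pos (by positivity)
  gcongr
  exact Real.Gamma_strictMonoOn_Ici.monotoneOn (by simp; linarith) (by simp; linarith)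
    (by linarith)

theorem mlPow_term_nonneg {α x : ℝ} (hα : 0 ≤ α) (hx : 0 ≤ x) (n : ℕ) :
    0 ≤ x ^ (α * n) / Real.Gamma (1 + α * n) := by
  have : 0 < Real.Gamma (1 + α * n) := Real.Gamma_pos_of_pos (by positivity)
  positivity

theorem summable_mlPow {α x : ℝ} (hα : 1 ≤ α) (hx : 0 ≤ x) :
    Summable fun n : ℕ ↦ x ^ (α * n) / Real.Gamma (1 + α * n) :=
  .of_nonneg_of_le (mlPow_term_nonneg (by linarith) hx) (pow_div_Gamma_le hα hx)
    (Real.summable_pow_div_factorial _)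

theorem continuousOn_mlPow {α : ℝ} (hα : 1 ≤ α) : ContinuousOn (mlPow α) (Set.Ioi 0) := by
  intro x (hx : 0 < x)
  have h : ContinuousOn (mlPow α) (Set.Icc 0 (x + 1)) := by
    refine continuousOn_tsum (u := fun n : ℕ ↦ ((x + 1) ^ α) ^ n / n.factorial) (fun n ↦ ?_)
      (Real.summable_pow_div_factorial _) fun n y hy ↦ ?_
    · exact ((Real.continuous_rpow_const (by positivity)).div_const _).continuousOn
    · rw [Real.norm_of_nonneg (mlPow_term_nonneg (by linarith) hy.1 n)]
      refine (pow_div_Gamma_le hα hy.1 n).trans ?_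
      have := hy.1
      have := hy.2
      gcongr
  exact (h.continuousAt (Icc_mem_nhds hx (by linarith))).continuousWithinAt

theorem mlPow_nonneg {α x : ℝ} (hα : 0 ≤ α) (hx : 0 ≤ x) : 0 ≤ mlPow α x :=
  tsum_nonneg (mlPow_term_nonneg hα hx)

theorem lintegral_exp_mul_rpow_Ioi {a p : ℝ} (ha : 0 ≤ a) (hp : 0 < p) :
    ∫⁻ x in Set.Ioi 0, ENNReal.ofReal (rexp (-p * x) * (x ^ a / Real.Gamma (1 + a))) =
      ENNReal.ofReal (p⁻¹ * p ^ (-a)) := by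
  have hΓ : 0 < Real.Gamma (1 + a) := Real.Gamma_pos_of_pos (by positivity)
  have key : ∫ x in Set.Ioi 0, rexp (-p * x) * (x ^ a / Real.Gamma (1 + a)) = p⁻¹ * p ^ (-a) := by
    have h := Real.integral_rpow_mul_exp_neg_mul_Ioi (a := 1 + a) (by positivity) hp
    rw [add_sub_cancel_left] at h
    have h2 : ∀ x : ℝ, rexp (-p * x) * (x ^ a / Real.Gamma (1 + a)) =
        (Real.Gamma (1 + a))⁻¹ * (x ^ a * rexp (-(p * x))) := by
      intro x
      rw [neg_mul]
      field_simp
    simp_rw [h2]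
    rw [integral_const_mul, h, one_div, Real.inv_rpow hp.le, Real.rpow_add hp, Real.rpow_one,
      Real.rpow_neg hp.le]
    field_simp
  rw [← key, ofReal_integral_eq_lintegral_ofReal]
  · exact Integrable.of_integral_ne_zero (by rw [key]; positivity)
  · filter_upwards [ae_restrict_mem measurableSet_Ioi] with x (hx : 0 < x)
    positivity

theorem lintegral_exp_neg_mul_Ioi {p : ℝ} (hp : 0 < p) :
    ∫⁻ x in Set.Ioi 0, ENNReal.ofReal (rexp (-p * x)) = ENNReal.ofReal p⁻¹ := by
  simpa using lintegral_exp_mul_rpow_Ioi le_rfl hp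

theorem lintegral_exp_mul_mlPow {α p : ℝ} (hα : 1 < α) (hp : 1 < p) :
    ∫⁻ x in Set.Ioi 0, ENNReal.ofReal (rexp (-p * x) * mlPow α x) =
      ENNReal.ofReal (p ^ (α - 1) / (p ^ α - 1)) := by
  have hp0 : 0 < p := by linarith
  have hα0 : 0 < α := by linarith
  have hq : p ^ (-α) < 1 := Real.rpow_lt_one_of_one_lt_of_neg hp (by linarith)
  have hq0 : 0 ≤ p ^ (-α) := by positivity
  have h1 : ∫⁻ x in Set.Ioi 0, ENNReal.ofReal (rexp (-p * x) * mlPow α x) =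
      ∫⁻ x in Set.Ioi 0, ∑' n : ℕ,
        ENNReal.ofReal (rexp (-p * x) * (x ^ (α * n) / Real.Gamma (1 + α * n))) := by
    refine setLIntegral_congr_fun measurableSet_Ioi fun x (hx : 0 < x) ↦ ?_
    rw [← ENNReal.ofReal_tsum_of_nonneg, tsum_mul_left, mlPow]
    · exact fun n ↦ mul_nonneg (by positivity) (mlPow_term_nonneg hα0.le hx.le n)
    · exact (summable_mlPow hα.le hx.le).mul_left _
  rw [h1, lintegral_tsum fun n ↦ by fun_prop]
  have h2 (n : ℕ) := lintegral_exp_mul_rpow_Ioi (a := α * n) (by positivity) hp0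
  simp_rw [h2]
  have h3 (n : ℕ) : p ^ (-(α * n)) = (p ^ (-α)) ^ n := by
    rw [← neg_mul, Real.rpow_mul hp0.le, Real.rpow_natCast]
  simp_rw [h3]
  rw [← ENNReal.ofReal_tsum_of_nonneg (fun n ↦ by positivity)
    ((summable_geometric_of_lt_one hq0 hq).mul_left _), tsum_mul_left,
    tsum_geometric_of_lt_one hq0 hq]
  congr 1
  have h4 : p ^ α - 1 ≠ 0 := by linarith [Real.one_lt_rpow hp hα0]
  rw [Real.rpow_sub_one hp0.ne', Real.rpow_neg hp0.le]
  have h5 : 1 - (p ^ α)⁻¹ = (p ^ α - 1) / p ^ α := by field_simp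
  rw [h5]
  field_simp

/-- The measure on `(0, ∞)` whose density is the kernel. -/
noncomputable def mlMeasure (α : ℝ) : Measure ℝ :=
  (volume.restrict (Set.Ioi 0)).withDensity fun t ↦ ENNReal.ofReal (mlKernel α t)

theorem integral_mlMeasure {α : ℝ} (hα : α ∈ Set.Ioo (1 : ℝ) 2) (f : ℝ → ℝ) :
    ∫ t, f t ∂(mlMeasure α) = ∫ t in Set.Ioi 0, f t * mlKernel α t := by
  rw [mlMeasure, integral_withDensity_eq_integral_toReal_smul
    (measurable_mlKernel α).ennreal_ofReal (Filter.Eventually.of_forall fun _ ↦ by simp)]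
  refine setIntegral_congr_fun measurableSet_Ioi fun t (ht : 0 < t) ↦ ?_
  simp [ENNReal.toReal_ofReal (mlKernel_nonneg hα ht.le), mul_comm]

theorem ae_mlMeasure_pos (α : ℝ) : ∀ᵐ t ∂(mlMeasure α), 0 < t :=
  (withDensity_absolutelyContinuous _ _).ae_le (ae_restrict_mem measurableSet_Ioi)

theorem isFiniteMeasure_mlMeasure {α : ℝ} (hα : α ∈ Set.Ioo (1 : ℝ) 2) :
    IsFiniteMeasure (mlMeasure α) :=
  isFiniteMeasure_withDensity_ofReal (integrableOn_mlKernel hα).2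

open ProbabilityTheory in
theorem Ioi_subset_interior_integrableExpSet_mlMeasure {α : ℝ} (hα : α ∈ Set.Ioo (1 : ℝ) 2) :
    Set.Ioi 0 ⊆ interior (integrableExpSet (fun t ↦ -t) (mlMeasure α)) := by
  have := isFiniteMeasure_mlMeasure hα
  refine isOpen_Ioi.subset_interior_iff.2 fun x (hx : 0 < x) ↦ ?_
  refine (integrable_const (1 : ℝ)).mono' (by fun_prop) ?_
  filter_upwards [ae_mlMeasure_pos α] with t ht
  rw [Real.norm_of_nonneg (by positivity), Real.exp_le_one_iff]
  nlinarith

open ProbabilityTheory in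
theorem mgf_mlMeasure {α : ℝ} (hα : α ∈ Set.Ioo (1 : ℝ) 2) (x : ℝ) :
    mgf (fun t ↦ -t) (mlMeasure α) x = ∫ t in Set.Ioi 0, rexp (-x * t) * mlKernel α t := by
  rw [mgf, integral_mlMeasure hα]
  simp

theorem lintegral_exp_mul_laplace_mlKernel {α p : ℝ} (hα : α ∈ Set.Ioo (1 : ℝ) 2) (hp : 0 < p) :
    ∫⁻ x in Set.Ioi 0, ENNReal.ofReal
        (rexp (-p * x) * ∫ t in Set.Ioi 0, rexp (-x * t) * mlKernel α t) =
      ENNReal.ofReal (∫ t in Set.Ioi 0, mlKernel α t / (p + t)) := by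
  have hmeas := measurable_mlKernel α
  have h1 : ∫⁻ x in Set.Ioi 0, ENNReal.ofReal
        (rexp (-p * x) * ∫ t in Set.Ioi 0, rexp (-x * t) * mlKernel α t) =
      ∫⁻ x in Set.Ioi 0, ∫⁻ t in Set.Ioi 0,
        ENNReal.ofReal (mlKernel α t) * ENNReal.ofReal (rexp (-(p + t) * x)) := by
    refine setLIntegral_congr_fun measurableSet_Ioi fun x (hx : 0 < x) ↦ ?_
    rw [← integral_const_mul, ofReal_integral_eq_lintegral_ofReal]
    · refine setLIntegral_congr_fun measurableSet_Ioi fun t (ht : 0 < t) ↦ ?_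
      rw [← ENNReal.ofReal_mul (mlKernel_nonneg hα ht.le), ← mul_assoc, ← Real.exp_add]
      ring_nf
    · refine ((integrableOn_mlKernel hα).bdd_mul (c := 1) (by fun_prop) ?_).const_mul _
      filter_upwards [ae_restrict_mem measurableSet_Ioi] with t (ht : 0 < t)
      rw [Real.norm_of_nonneg (by positivity), Real.exp_le_one_iff]
      nlinarith
    · filter_upwards [ae_restrict_mem measurableSet_Ioi] with t (ht : 0 < t)
      have := mlKernel_nonneg hα ht.le
      positivity
  rw [h1, lintegral_lintegral_swap (by fun_prop),
    ofReal_integral_eq_lintegral_ofReal (integrableOn_mlKernel_div hα hp)]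
  · refine setLIntegral_congr_fun measurableSet_Ioi fun t (ht : 0 < t) ↦ ?_
    have hpt : 0 < p + t := by positivity
    rw [lintegral_const_mul _ (by fun_prop), lintegral_exp_neg_mul_Ioi hpt,
      ← ENNReal.ofReal_mul (mlKernel_nonneg hα ht.le), div_eq_mul_inv]
  · filter_upwards [ae_restrict_mem measurableSet_Ioi] with t (ht : 0 < t)
    have := mlKernel_nonneg hα ht.le
    exact div_nonneg this (by positivity)

theorem continuousOn_laplace_mlKernel {α : ℝ} (hα : α ∈ Set.Ioo (1 : ℝ) 2) :
    ContinuousOn (fun x ↦ ∫ t in Set.Ioi 0, rexp (-x * t) * mlKernel α t) (Set.Ioi 0) := by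
  simp_rw [← mgf_mlMeasure hα]
  exact ProbabilityTheory.continuousOn_mgf.mono
    (Ioi_subset_interior_integrableExpSet_mlMeasure hα)

theorem laplace_mlKernel_nonneg {α : ℝ} (hα : α ∈ Set.Ioo (1 : ℝ) 2) (x : ℝ) :
    0 ≤ ∫ t in Set.Ioi 0, rexp (-x * t) * mlKernel α t :=
  setIntegral_nonneg measurableSet_Ioi fun t (ht : 0 < t) ↦
    mul_nonneg (Real.exp_pos _).le (mlKernel_nonneg hα ht.le)

theorem mlPow_eq_exp_add_laplace {α : ℝ} (hα : α ∈ Set.Ioo (1 : ℝ) 2) :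
    Set.EqOn (mlPow α)
      (fun x ↦ rexp x / α + ∫ t in Set.Ioi 0, rexp (-x * t) * mlKernel α t) (Set.Ioi 0) := by
  have hα0 : 0 < α := by linarith [hα.1]
  refine eqOn_Ioi_of_lintegral_laplace_eq (a := 1) (continuousOn_mlPow hα.1.le)
    (ContinuousOn.add (by fun_prop) (continuousOn_laplace_mlKernel hα))
    (fun x hx ↦ mlPow_nonneg hα0.le hx.le)
    (fun x _ ↦ add_nonneg (by positivity) (laplace_mlKernel_nonneg hα x))
    (fun p hp ↦ by rw [lintegral_exp_mul_mlPow hα.1 hp]; exact ENNReal.ofReal_ne_top)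
    fun p hp ↦ ?_
  have hp1 : 0 < p - 1 := by linarith
  have hint : 0 ≤ ∫ t in Set.Ioi 0, mlKernel α t / (p + t) :=
    setIntegral_nonneg measurableSet_Ioi fun t (ht : 0 < t) ↦
      div_nonneg (mlKernel_nonneg hα ht.le) (by linarith)
  have h1 (x : ℝ) : ENNReal.ofReal (rexp (-p * x) *
        (rexp x / α + ∫ t in Set.Ioi 0, rexp (-x * t) * mlKernel α t)) =
      ENNReal.ofReal α⁻¹ * ENNReal.ofReal (rexp (-(p - 1) * x)) + ENNReal.ofReal
        (rexp (-p * x) * ∫ t in Set.Ioi 0, rexp (-x * t) * mlKernel α t) := by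
    have h2 := laplace_mlKernel_nonneg hα x
    rw [← ENNReal.ofReal_mul (by positivity),
      ← ENNReal.ofReal_add (by positivity) (by positivity)]
    have h3 : rexp (-(p - 1) * x) = rexp (-p * x) * rexp x := by
      rw [← Real.exp_add]; ring_nf
    rw [h3]
    ring_nf
  simp_rw [h1]
  rw [lintegral_add_left (by fun_prop), lintegral_const_mul _ (by fun_prop),
    lintegral_exp_neg_mul_Ioi hp1, lintegral_exp_mul_laplace_mlKernel hα (by linarith),
    lintegral_exp_mul_mlPow hα.1 hp, ← ENNReal.ofReal_mul (by positivity),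
    ← ENNReal.ofReal_add (by positivity) hint, integral_mlKernel_div hα hp]
  congr 1
  field_simp
  ring

open ProbabilityTheory in
theorem completelyMonotonicOn_laplace_mlKernel {α : ℝ} (hα : α ∈ Set.Ioo (1 : ℝ) 2) :
    CompletelyMonotonicOn fun x ↦ ∫ t in Set.Ioi 0, rexp (-x * t) * mlKernel α t := by
  intro n x hx
  simp_rw [← mgf_mlMeasure hα]
  rw [iteratedDeriv_mgf (Ioi_subset_interior_integrableExpSet_mlMeasure hα hx),
    ← integral_const_mul]
  refine integral_nonneg_of_ae ?_
  filter_upwards [ae_mlMeasure_pos α] with t ht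
  simp only [Pi.zero_apply]
  rw [← mul_assoc, ← mul_pow, neg_one_mul, neg_neg]
  positivity

theorem ml_sub_exp_CM (α : ℝ) (hα : α ∈ Set.Ioo (1:ℝ) 2) :
    (∀ x : ℝ, 0 < x →
        mlPow α x - Real.exp x / α =
          ∫ t in Set.Ioi (0:ℝ), Real.exp (-x * t) *
            ((-Real.sin (Real.pi * α)) * t ^ (α - 1) /
              (Real.pi * (t ^ (2 * α) - 2 * Real.cos (Real.pi * α) * t ^ α + 1)))) ∧
      CompletelyMonotonicOn (fun x => mlPow α x - Real.exp x / α) := by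
  have key : ∀ x : ℝ, 0 < x → mlPow α x - Real.exp x / α =
      ∫ t in Set.Ioi 0, rexp (-x * t) * mlKernel α t := fun x hx ↦ by
    rw [mlPow_eq_exp_add_laplace hα hx, add_sub_cancel_left]
  refine ⟨key, fun n x hx ↦ ?_⟩
  have h : (fun x ↦ mlPow α x - Real.exp x / α) =ᶠ[nhds x]
      fun x ↦ ∫ t in Set.Ioi 0, rexp (-x * t) * mlKernel α t := by
    filter_upwards [Ioi_mem_nhds hx] with y hy using key y hy
  rw [h.iteratedDeriv_eq]
  exact completelyMonotonicOn_laplace_mlKernel hα n x hx
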